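/- Let α ∈ (0,1), λ ≥ 0, Δt > 0, and t_n = nΔt. Let V be a real vector space and let B : V × V → ℝ be a bilinear form that is symmetric (B(u,v) = B(v,u)) and positive semidefinite (B(v,v) ≥ 0 for all v). Then for every positive integer N and every choice of vectors v₀, v₁, …, v_N ∈ V with v₀ = 0, the double sum Σ_{n=1}^{N} Σ_{p=0}^{n} ω_p^{(α,λ)} B(v_{n−p}, v_n) is nonnegative. -/

import Mathlib

/-- `σ_s^{(α)} = Γ(α+s)/(Γ(α)Γ(s+1))`. -/
noncomputable def cqSigma (α : ℝ) (s : ℕ) : ℝ :=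
  Real.Gamma (α + s) / (Real.Gamma α * Real.Gamma (s + 1))

/-- `β_s^{(α)} = α(α−1)⋯(α−s+1)/s!`. -/
noncomputable def cqBeta (α : ℝ) (s : ℕ) : ℝ :=
  (∏ i ∈ Finset.range s, (α - i)) / (Nat.factorial s)

/-- Convolution-quadrature weight `ω_n^{(α,0)} = 2^{−α} Σ_{s=0}^n σ_s^{(α)} β_{n−s}^{(α)}`. -/
noncomputable def cqWeight (α : ℝ) (n : ℕ) : ℝ :=
  (2 : ℝ) ^ (-α) * ∑ s ∈ Finset.range (n + 1), cqSigma α s * cqBeta α (n - s)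

/-- Tempered weight `ω_n^{(α,λ)} = e^{−λ t_n} ω_n^{(α,0)}` with `t_n = nΔt`. -/
noncomputable def temperedWeight (α lam Δt : ℝ) (n : ℕ) : ℝ :=
  Real.exp (-(lam * (n * Δt))) * cqWeight α n


lemma cqBeta_eq_choose (a : ℝ) (n : ℕ) : cqBeta a n = Ring.choose a n := by
  rw [Ring.choose_eq_smul, cqBeta, ← descPochhammer_eval_eq_prod_range,
    Polynomial.descPochhammer_smeval_eq_ascPochhammer,
    Polynomial.ascPochhammer_smeval_eq_eval, descPochhammer_eval_eq_ascPochhammer]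
  simp [div_eq_inv_mul]

lemma cqSigma_eq (α : ℝ) (hα : 0 < α) (n : ℕ) : cqSigma α n = (-1) ^ n * cqBeta (-α) n := by
  have hG : Real.Gamma (α + n) = Real.Gamma α * ((-1) ^ n * ∏ i ∈ Finset.range n, (-α - i)) := by
    induction n with
    | zero => simp
    | succ k ih =>
      have : α + ((k + 1 : ℕ) : ℝ) = (α + k) + 1 := by push_cast; ring
      rw [this, Real.Gamma_add_one (by positivity), ih, Finset.prod_range_succ]
      ring
  have h0 : Real.Gamma α ≠ 0 := (Real.Gamma_pos_of_pos hα).ne'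
  rw [cqSigma, cqBeta, hG, Real.Gamma_nat_eq_factorial]
  field_simp

lemma cqBeta_summable (a : ℝ) (z : ℂ) (hz : ‖z‖ < 1) :
    Summable (fun n => ‖(cqBeta a n : ℂ) * z ^ n‖) := by
  have hm : z ∈ Metric.eball (0 : ℂ) (binomialSeries ℂ (a : ℂ)).radius := by
    refine Metric.eball_subset_eball binomialSeries_radius_ge_one ?_
    simpa [← ENNReal.ofReal_one, Metric.eball_ofReal] using hz
  have := FormalMultilinearSeries.summable_norm_apply _ hm
  refine this.congr fun n => ?_
  rw [binomialSeries_apply, cqBeta_eq_choose, Complex.ofReal_choose]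
  simp

lemma cqBeta_tsum (a : ℝ) (z : ℂ) (hz : ‖z‖ < 1) :
    ∑' n, (cqBeta a n : ℂ) * z ^ n = (1 + z) ^ (a : ℂ) := by
  have hm : z ∈ Metric.eball (0 : ℂ) 1 := by
    simpa [← ENNReal.ofReal_one, Metric.eball_ofReal] using hz
  have := (Complex.one_add_cpow_hasFPowerSeriesOnBall_zero (a := (a : ℂ))).hasSum hm
  rw [zero_add] at this
  rw [← this.tsum_eq]
  refine tsum_congr fun n => ?_
  rw [binomialSeries_apply, cqBeta_eq_choose, Complex.ofReal_choose]
  simp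

/-- unnormalised weights -/
noncomputable def cqA (α : ℝ) (n : ℕ) : ℝ :=
  ∑ s ∈ Finset.range (n + 1), cqSigma α s * cqBeta α (n - s)

lemma cqA_term (α : ℝ) (hα : 0 < α) (z : ℂ) (n : ℕ) : (cqA α n : ℂ) * z ^ n =
    ∑ s ∈ Finset.range (n + 1),
      ((cqBeta (-α) s : ℂ) * (-z) ^ s) * ((cqBeta α (n - s) : ℂ) * z ^ (n - s)) := by
  rw [cqA]
  push_cast
  rw [Finset.sum_mul]
  refine Finset.sum_congr rfl fun s hs => ?_
  have hs' : s ≤ n := by simpa [Nat.lt_succ_iff] using hs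
  rw [cqSigma_eq α hα, ← Nat.add_sub_of_le hs', Nat.add_sub_cancel_left, pow_add, neg_pow]
  push_cast
  ring

lemma cqA_summable (α : ℝ) (hα : 0 < α) (z : ℂ) (hz : ‖z‖ < 1) :
    Summable (fun n => ‖(cqA α n : ℂ) * z ^ n‖) := by
  simp_rw [cqA_term α hα]
  exact summable_norm_sum_mul_range_of_summable_norm
    (f := fun s => (cqBeta (-α) s : ℂ) * (-z) ^ s) (g := fun s => (cqBeta α s : ℂ) * z ^ s)
    (cqBeta_summable (-α) (-z) (by simpa using hz)) (cqBeta_summable α z hz)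

lemma cqA_hasSum (α : ℝ) (hα : 0 < α) (z : ℂ) (hz : ‖z‖ < 1) :
    HasSum (fun n => (cqA α n : ℂ) * z ^ n) ((1 + -z) ^ ((-α : ℝ) : ℂ) * (1 + z) ^ (α : ℂ)) := by
  simp_rw [cqA_term α hα]
  rw [← cqBeta_tsum (-α) (-z) (by simpa using hz), ← cqBeta_tsum α z hz]
  exact hasSum_sum_range_mul_of_summable_norm
    (f := fun s => (cqBeta (-α) s : ℂ) * (-z) ^ s) (g := fun s => (cqBeta α s : ℂ) * z ^ s)
    (cqBeta_summable (-α) (-z) (by simpa using hz)) (cqBeta_summable α z hz)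

lemma cq_re_nonneg (α : ℝ) (hα : α ∈ Set.Ioo (0 : ℝ) 1) (z : ℂ) (hz : ‖z‖ < 1) :
    0 ≤ ((1 + -z) ^ ((-α : ℝ) : ℂ) * (1 + z) ^ (α : ℂ)).re := by
  have hre : |z.re| < 1 := (Complex.abs_re_le_norm z).trans_lt hz
  rw [abs_lt] at hre
  have p1 : 0 < (1 + z).re := by simp; linarith
  have p2 : 0 < (1 + -z).re := by simp; linarith
  have n1 : (1 + z) ≠ 0 := fun h => by rw [h] at p1; simp at p1
  have n2 : (1 + -z) ≠ 0 := fun h => by rw [h] at p2; simp at p2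
  have a1 := Complex.abs_arg_lt_pi_div_two_iff.2 (Or.inl p1)
  have a2 := Complex.abs_arg_lt_pi_div_two_iff.2 (Or.inl p2)
  rw [abs_lt] at a1 a2
  set w := Complex.log (1 + z) - Complex.log (1 + -z) with hw
  have him : w.im = (1 + z).arg - (1 + -z).arg := by simp [hw, Complex.log_im]
  have hexp : Complex.exp w = (1 + z) / (1 + -z) := by
    rw [hw, Complex.exp_sub, Complex.exp_log n1, Complex.exp_log n2]
  have hlog : Complex.log ((1 + z) / (1 + -z)) = w := by
    rw [← hexp, Complex.log_exp] <;> rw [him] <;> linarith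
  have hq : 0 ≤ ((1 + z) / (1 + -z)).re := by
    have hn : ‖z‖ ^ 2 < 1 := by nlinarith [norm_nonneg z]
    rw [← Complex.normSq_eq_norm_sq, Complex.normSq_apply] at hn
    rw [Complex.div_re, ← add_div]
    apply div_nonneg _ (Complex.normSq_nonneg _)
    simp
    nlinarith
  have hle := Complex.abs_arg_le_pi_div_two_iff.2 hq
  rw [← Complex.log_im, hlog, abs_le] at hle
  rw [Complex.cpow_def_of_ne_zero n1, Complex.cpow_def_of_ne_zero n2, ← Complex.exp_add]
  have : Complex.log (1 + -z) * ((-α : ℝ) : ℂ) + Complex.log (1 + z) * (α : ℂ) = (α : ℂ) * w := by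
    rw [hw]; push_cast; ring
  rw [this, Complex.exp_re]
  apply mul_nonneg (Real.exp_pos _).le
  have : ((α : ℂ) * w).im = α * w.im := by simp
  rw [this]
  obtain ⟨h0, h1⟩ := hα
  apply Real.cos_nonneg_of_neg_pi_div_two_le_of_le <;> nlinarith [Real.pi_pos]

lemma integral_cos_int (m : ℤ) :
    ∫ x in (0 : ℝ)..(2 * Real.pi), Real.cos (m * x) = if m = 0 then 2 * Real.pi else 0 := by
  split_ifs with h
  · simp [h]
  · have hm : (m : ℝ) ≠ 0 := by exact_mod_cast h
    rw [intervalIntegral.integral_comp_mul_left (fun x => Real.cos x) hm, integral_cos]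
    have := Real.sin_int_mul_pi (m * 2)
    push_cast at this
    rw [← mul_assoc, this]
    simp

lemma integral_cos_mul_cos (n j : ℕ) :
    ∫ x in (0 : ℝ)..(2 * Real.pi), Real.cos (n * x) * Real.cos (j * x) =
      if n = j then (if j = 0 then 2 * Real.pi else Real.pi) else 0 := by
  have h : ∀ x : ℝ, Real.cos (n * x) * Real.cos (j * x) =
      (1 / 2) * (Real.cos (((n - j : ℤ) : ℝ) * x) + Real.cos (((n + j : ℤ) : ℝ) * x)) := by
    intro x
    push_cast
    rw [sub_mul, add_mul, Real.cos_sub, Real.cos_add]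
    ring
  simp_rw [h]
  rw [intervalIntegral.integral_const_mul, intervalIntegral.integral_add
    (by apply Continuous.intervalIntegrable; fun_prop)
    (by apply Continuous.intervalIntegrable; fun_prop), integral_cos_int, integral_cos_int]
  split_ifs <;> first | omega | ring

lemma cosSeries_continuous (a : ℕ → ℝ) (ha : Summable fun n => |a n|) :
    Continuous (fun x : ℝ => ∑' n, a n * Real.cos (n * x)) := by
  refine continuous_tsum (fun n => by fun_prop) ha fun n x => ?_
  rw [Real.norm_eq_abs, abs_mul]
  exact mul_le_of_le_one_right (abs_nonneg _) (Real.abs_cos_le_one _)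

lemma cosSeries_coeff (a : ℕ → ℝ) (ha : Summable fun n => |a n|) (j : ℕ) :
    ∫ x in (0 : ℝ)..(2 * Real.pi), (∑' n, a n * Real.cos (n * x)) * Real.cos (j * x) =
      a j * (if j = 0 then 2 * Real.pi else Real.pi) := by
  have hs : ∀ x : ℝ, Summable fun n : ℕ => a n * Real.cos (n * x) := fun x => by
    refine Summable.of_norm_bounded ha fun n => ?_
    rw [Real.norm_eq_abs, abs_mul]
    exact mul_le_of_le_one_right (abs_nonneg _) (Real.abs_cos_le_one _)
  have key := intervalIntegral.hasSum_integral_of_dominated_convergence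
    (μ := MeasureTheory.volume) (a := (0 : ℝ)) (b := 2 * Real.pi)
    (F := fun (n : ℕ) x => a n * Real.cos (n * x) * Real.cos (j * x))
    (f := fun x => (∑' n, a n * Real.cos (n * x)) * Real.cos (j * x))
    (fun n _ => |a n|)
    (fun n => by apply Continuous.aestronglyMeasurable; fun_prop)
    (fun n => Filter.Eventually.of_forall fun x _ => by
      rw [Real.norm_eq_abs, abs_mul, abs_mul, mul_assoc]
      exact mul_le_of_le_one_right (abs_nonneg _)
        (mul_le_one₀ (Real.abs_cos_le_one _) (abs_nonneg _) (Real.abs_cos_le_one _)))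
    (Filter.Eventually.of_forall fun x _ => ha)
    (by simp)
    (Filter.Eventually.of_forall fun x _ => (hs x).hasSum.mul_right _)
  have h2 : ∀ n : ℕ, ∫ x in (0 : ℝ)..(2 * Real.pi), a n * Real.cos (n * x) * Real.cos (j * x) =
      if n = j then a j * (if j = 0 then 2 * Real.pi else Real.pi) else 0 := by
    intro n
    simp_rw [mul_assoc]
    rw [intervalIntegral.integral_const_mul, integral_cos_mul_cos]
    by_cases h : n = j
    · subst h; simp
    · simp [h]
  simp_rw [h2] at key
  exact key.unique (hasSum_ite_eq j _)

lemma sym_sum (d b : ℕ → ℕ → ℝ) (a : ℕ → ℝ) (C : ℝ)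
    (hd : ∀ n m, d n m = d m n) (hb : ∀ n m, b n m = b m n)
    (hda : ∀ n m, m ≤ n → d n m = a (n - m) * (if n - m = 0 then 2 * C else C)) (N : ℕ) :
    ∑ n ∈ Finset.range N, ∑ m ∈ Finset.range N, d n m * b m n =
      2 * C * ∑ n ∈ Finset.range N, ∑ p ∈ Finset.range (n + 1), a p * b (n - p) n := by
  induction N with
  | zero => simp
  | succ N ih =>
    rw [Finset.sum_range_succ _ N]
    simp_rw [Finset.sum_range_succ _ N]
    rw [Finset.sum_add_distrib, ih, mul_add]
    have h1 : ∑ n ∈ Finset.range N, d n N * b N n = ∑ n ∈ Finset.range N, C * (a (N - n) * b n N) := by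
      refine Finset.sum_congr rfl fun n hn => ?_
      have hn := Finset.mem_range.1 hn
      rw [hd, hb, hda _ _ hn.le, if_neg (by omega)]; ring
    have h2 : ∑ m ∈ Finset.range N, d N m * b m N = ∑ n ∈ Finset.range N, C * (a (N - n) * b n N) := by
      refine Finset.sum_congr rfl fun n hn => ?_
      have hn := Finset.mem_range.1 hn
      rw [hda _ _ hn.le, if_neg (by omega)]; ring
    have h3 : ∑ p ∈ Finset.range N, a p * b (N - p) N + a N * b (N - N) N
        = ∑ n ∈ Finset.range N, a (N - n) * b n N + a 0 * b N N := by
      rw [← Finset.sum_range_succ (fun p => a p * b (N - p) N), ← Finset.sum_range_reflect,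
        Finset.sum_range_succ]
      congr 1
      · refine Finset.sum_congr rfl fun n hn => ?_
        have hn := Finset.mem_range.1 hn
        have e1 : N + 1 - 1 - n = N - n := by omega
        have e2 : N - (N - n) = n := by omega
        rw [e1, e2]
      · simp
    rw [h1, h2, h3, hda N N le_rfl, ← Finset.mul_sum]
    simp
    ring

lemma toeplitz_nonneg {V : Type*} [AddCommGroup V] [Module ℝ V]
    (B : V →ₗ[ℝ] V →ₗ[ℝ] ℝ) (hsymm : ∀ u v : V, B u v = B v u) (hpsd : ∀ v : V, 0 ≤ B v v)
    (a : ℕ → ℝ) (ha : Summable fun n => |a n|)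
    (hpos : ∀ x : ℝ, 0 ≤ ∑' n, a n * Real.cos (n * x)) (v : ℕ → V) (N : ℕ) :
    0 ≤ ∑ n ∈ Finset.range N, ∑ p ∈ Finset.range (n + 1), a p * B (v (n - p)) (v n) := by
  set G : ℝ → ℝ := fun x => ∑' n, a n * Real.cos (n * x) with hG
  have hGc : Continuous G := cosSeries_continuous a ha
  set d : ℕ → ℕ → ℝ := fun n m =>
    ∫ x in (0 : ℝ)..(2 * Real.pi), G x * Real.cos (((n : ℝ) - m) * x) with hd
  have hS := sym_sum d (fun n m => B (v n) (v m)) a Real.pi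
    (fun n m => by
      simp only [hd]
      congr 1
      ext x
      rw [← Real.cos_neg]
      congr 2
      ring)
    (fun n m => hsymm _ _)
    (fun n m h => by
      rw [← cosSeries_coeff a ha]
      simp only [hd, hG, Nat.cast_sub h]) N
  have hpi := Real.pi_pos
  suffices h : 0 ≤ ∑ n ∈ Finset.range N, ∑ m ∈ Finset.range N, d n m * B (v m) (v n) by
    rw [hS] at h
    exact nonneg_of_mul_nonneg_right h (by positivity)
  have hI : ∑ n ∈ Finset.range N, ∑ m ∈ Finset.range N, d n m * B (v m) (v n) =
      ∫ x in (0 : ℝ)..(2 * Real.pi), ∑ n ∈ Finset.range N, ∑ m ∈ Finset.range N,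
        G x * Real.cos (((n : ℝ) - m) * x) * B (v m) (v n) := by
    rw [intervalIntegral.integral_finsetSum
      (fun n _ => by apply Continuous.intervalIntegrable; fun_prop)]
    refine Finset.sum_congr rfl fun n _ => ?_
    rw [intervalIntegral.integral_finsetSum
      (fun n _ => by apply Continuous.intervalIntegrable; fun_prop)]
    refine Finset.sum_congr rfl fun m _ => ?_
    rw [intervalIntegral.integral_mul_const]
  rw [hI]
  refine intervalIntegral.integral_nonneg (by positivity) fun x _ => ?_
  set Cv := ∑ n ∈ Finset.range N, Real.cos (n * x) • v n with hC
  set Sv := ∑ n ∈ Finset.range N, Real.sin (n * x) • v n with hSv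
  have : ∑ n ∈ Finset.range N, ∑ m ∈ Finset.range N,
        G x * Real.cos (((n : ℝ) - m) * x) * B (v m) (v n) = G x * (B Cv Cv + B Sv Sv) := by
    simp only [hC, hSv, map_sum, LinearMap.sum_apply, map_smul, LinearMap.smul_apply, smul_eq_mul,
      Finset.mul_sum, ← Finset.sum_add_distrib]
    refine Finset.sum_congr rfl fun n _ => Finset.sum_congr rfl fun m _ => ?_
    rw [sub_mul, Real.cos_sub]
    ring
  rw [this]
  exact mul_nonneg (hpos x) (add_nonneg (hpsd _) (hpsd _))

lemma cqA_disc {V : Type*} [AddCommGroup V] [Module ℝ V]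
    (B : V →ₗ[ℝ] V →ₗ[ℝ] ℝ) (hsymm : ∀ u v : V, B u v = B v u) (hpsd : ∀ v : V, 0 ≤ B v v)
    (α : ℝ) (hα : α ∈ Set.Ioo (0 : ℝ) 1) (v : ℕ → V) (N : ℕ) (r : ℝ) (hr : r ∈ Set.Ioo (0 : ℝ) 1) :
    0 ≤ ∑ n ∈ Finset.range N, ∑ p ∈ Finset.range (n + 1),
      (cqA α p * r ^ p) * B (v (n - p)) (v n) := by
  obtain ⟨hr0, hr1⟩ := hr
  refine toeplitz_nonneg B hsymm hpsd (fun p => cqA α p * r ^ p) ?_ ?_ v N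
  · refine (cqA_summable α hα.1 (r : ℂ) (by simpa [abs_of_pos hr0] using hr1)).congr fun n => ?_
    rw [← Complex.ofReal_pow, ← Complex.ofReal_mul, Complex.norm_real, Real.norm_eq_abs]
  · intro x
    set z : ℂ := r * Complex.exp (x * Complex.I) with hzdef
    have hz : ‖z‖ < 1 := by
      rw [hzdef, norm_mul, Complex.norm_exp_ofReal_mul_I]
      simpa [abs_of_pos hr0] using hr1
    have h := Complex.hasSum_re (cqA_hasSum α hα.1 z hz)
    have e : ∀ n : ℕ, ((cqA α n : ℂ) * z ^ n).re = cqA α n * r ^ n * Real.cos (n * x) := by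
      intro n
      have : z ^ n = ((r ^ n : ℝ) : ℂ) * Complex.exp (((n * x : ℝ) : ℂ) * Complex.I) := by
        rw [hzdef, mul_pow, ← Complex.exp_nat_mul]
        push_cast
        congr 2
        ring
      rw [this, ← mul_assoc, ← Complex.ofReal_mul, Complex.re_ofReal_mul,
        Complex.exp_ofReal_mul_I_re]
    simp_rw [e] at h
    rw [h.tsum_eq]
    exact cq_re_nonneg α hα z hz

/-- positive definiteness of the tempered convolution-quadrature
weights against a symmetric positive semidefinite bilinear form `B`:
`Σ_{n=1}^N Σ_{p=0}^n ω_p^{(α,λ)} B(v_{n−p}, v_n) ≥ 0` whenever `v₀ = 0`. -/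
theorem tempered_weights_positive_definite_bilinear
    (α lam Δt : ℝ) (hα : α ∈ Set.Ioo (0 : ℝ) 1) (hlam : 0 ≤ lam) (hΔt : 0 < Δt)
    (V : Type*) [AddCommGroup V] [Module ℝ V]
    (B : V →ₗ[ℝ] V →ₗ[ℝ] ℝ)
    (hsymm : ∀ u v : V, B u v = B v u)
    (hpsd : ∀ v : V, 0 ≤ B v v)
    (N : ℕ) (hN : 1 ≤ N)
    (v : ℕ → V) (hv0 : v 0 = 0) :
    0 ≤ ∑ n ∈ Finset.Icc 1 N, ∑ p ∈ Finset.range (n + 1),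
        temperedWeight α lam Δt p * B (v (n - p)) (v n) := by
  set ρ := Real.exp (-(lam * Δt)) with hρ
  have hρ0 : 0 < ρ := Real.exp_pos _
  have hρ1 : ρ ≤ 1 := Real.exp_le_one_iff.2 (by nlinarith)
  let g : ℝ → ℝ := fun r => ∑ n ∈ Finset.range (N + 1), ∑ p ∈ Finset.range (n + 1),
    (cqA α p * r ^ p) * B (v (n - p)) (v n)
  have hg : Continuous g := by fun_prop
  have hgρ : 0 ≤ g ρ := by
    have hsub : closure (Set.Ioo (0 : ℝ) 1) ⊆ {r | 0 ≤ g r} :=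
      closure_minimal (fun r hr => cqA_disc B hsymm hpsd α hα v (N + 1) r hr)
        (isClosed_le continuous_const hg)
    apply hsub
    rw [closure_Ioo (by norm_num)]
    exact ⟨hρ0.le, hρ1⟩
  have hsum : ∑ n ∈ Finset.Icc 1 N, ∑ p ∈ Finset.range (n + 1),
        temperedWeight α lam Δt p * B (v (n - p)) (v n) = (2 : ℝ) ^ (-α) * g ρ := by
    have hI : Finset.range (N + 1) = insert 0 (Finset.Icc 1 N) := by
      ext k; simp; omega
    simp only [g]
    rw [hI, Finset.sum_insert (by simp)]
    simp only [zero_add, Finset.sum_range_one, hv0, map_zero, mul_zero]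
    rw [Finset.mul_sum]
    refine Finset.sum_congr rfl fun n _ => ?_
    rw [Finset.mul_sum]
    refine Finset.sum_congr rfl fun p _ => ?_
    rw [temperedWeight, cqWeight, hρ, ← Real.exp_nat_mul, cqA]
    have : -(lam * ((p : ℝ) * Δt)) = p * -(lam * Δt) := by ring
    rw [this]
    ring
  rw [hsum]
  positivity
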